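/- Let M be a left-cancellative monoid (for all x, y, z ∈ M, x·y = x·z implies y = z) generated by the images of a finite alphabet Σ under a surjective evaluation homomorphism eval : Σ* → M, and let U ⊆ M be a subset such that for all u, v ∈ U the elements u·v and v generate the same principal left ideal of M (M·(uv) = M·v, i.e. uv and v are L-related). If the submonoid of M generated by U is isomorphic to the trace monoid T(P_4), then there exists a regular language L ⊆ Σ* such that membership in the rational subset eval(L) of M is undecidable: the predicate w ↦ eval(w) ∈ eval(L) on words is not computable. -/

import Mathlib

/-- The defining relations of the trace monoid `T(P_4)` of the path with four vertices:
consecutive generators commute. -/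
def tracePathRel : FreeMonoid (Fin 4) → FreeMonoid (Fin 4) → Prop := fun p q =>
  ∃ i : Fin 3, p = FreeMonoid.of i.castSucc * FreeMonoid.of i.succ ∧
    q = FreeMonoid.of i.succ * FreeMonoid.of i.castSucc

/-- The trace monoid `T(P_4)`. -/
abbrev TP4 := PresentedMonoid tracePathRel

open scoped Pointwise

section RegularLanguages

variable {α : Type*}

theorem isRegular_singleton (w : List α) : Language.IsRegular ({w} : Language α) := by
  apply Language.IsRegular.of_finite_range_leftQuotient
  refine (((List.finite_toSet w.tails).image fun s => ({s} : Language α)).insert 0).subset ?_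
  rintro _ ⟨x, rfl⟩
  by_cases h : ∃ y, x ++ y = w
  · obtain ⟨y, rfl⟩ := h
    refine Or.inr ⟨y, by simp, ?_⟩
    ext z
    change z = y ↔ x ++ z = x ++ y
    simp
  · refine Or.inl ?_
    ext z
    exact ⟨fun hz => (h ⟨z, hz⟩).elim, fun hz => hz.elim⟩

theorem isRegular_empty : Language.IsRegular (∅ : Set (List α)) := by
  apply Language.IsRegular.of_finite_range_leftQuotient
  refine (Set.finite_singleton (∅ : Set (List α))).subset ?_
  rintro _ ⟨x, rfl⟩
  rfl

theorem Language.IsRegular.mul {K L : Language α} (hK : K.IsRegular) (hL : L.IsRegular) :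
    (K * L).IsRegular := by
  apply Language.IsRegular.of_finite_range_leftQuotient
  have hfin := hK.finite_range_leftQuotient.prod hL.finite_range_leftQuotient.powerset
  refine (hfin.image fun p => (p.1 * L + ⨆ Q ∈ p.2, Q : Language α)).subset ?_
  rintro _ ⟨x, rfl⟩
  refine ⟨(K.leftQuotient x, {Q | ∃ x₁ x₂, x₁ ++ x₂ = x ∧ x₁ ∈ K ∧ L.leftQuotient x₂ = Q}),
    ⟨⟨x, rfl⟩, ?_⟩, ?_⟩
  · rintro _ ⟨x₁, x₂, -, -, rfl⟩
    exact ⟨x₂, rfl⟩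
  · ext y
    simp only [Language.mem_add, Language.mem_iSup, exists_prop]
    rw [Language.mem_mul, Language.mem_leftQuotient, Language.mem_mul]
    constructor
    · rintro (⟨a, ha, b, hb, rfl⟩ | ⟨_, ⟨x₁, x₂, rfl, hx₁, rfl⟩, hy⟩)
      · exact ⟨x ++ a, ha, b, hb, by simp⟩
      · exact ⟨x₁, hx₁, x₂ ++ y, hy, by simp⟩
    · rintro ⟨a, ha, b, hb, hab⟩
      rcases List.append_eq_append_iff.1 hab with ⟨c, rfl, rfl⟩ | ⟨c, rfl, rfl⟩
      · exact Or.inr ⟨_, ⟨a, c, rfl, ha, rfl⟩, hb⟩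
      · exact Or.inl ⟨c, ha, b, hb, rfl⟩

theorem append_mem_kstar_iff {L : Language α} {x y : List α} (hx : x ≠ []) :
    x ++ y ∈ KStar.kstar L ↔ ∃ x₁ x₂, x₁ ++ x₂ = x ∧ x₁ ∈ KStar.kstar L ∧
      y ∈ L.leftQuotient x₂ * KStar.kstar L := by
  constructor
  · intro h
    obtain ⟨S, hS, hSL⟩ := Language.mem_kstar.1 h
    clear h
    induction S generalizing x with
    | nil => simp_all
    | cons w S ih =>
      rw [List.flatten_cons] at hS
      have hS' : S.flatten ∈ KStar.kstar L :=
        Language.join_mem_kstar fun z hz => hSL z (List.mem_cons_of_mem _ hz)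
      have hw : w ∈ L := hSL w (by simp)
      rcases List.append_eq_append_iff.1 hS with ⟨c, rfl, rfl⟩ | ⟨c, rfl, hc⟩
      · exact ⟨[], x, rfl, Language.nil_mem_kstar _, Language.append_mem_mul hw hS'⟩
      · rcases eq_or_ne c [] with rfl | hc'
        · refine ⟨[], w, by simp, Language.nil_mem_kstar _, ?_⟩
          rw [List.nil_append] at hc
          rw [← hc, ← List.nil_append S.flatten]
          exact Language.append_mem_mul (by simpa using hw) hS'
        · obtain ⟨x₁, x₂, rfl, hx₁, hy⟩ :=
            ih hc' hc.symm fun z hz => hSL z (List.mem_cons_of_mem _ hz)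
          refine ⟨w ++ x₁, x₂, by simp, ?_, hy⟩
          obtain ⟨T, rfl, hT⟩ := Language.mem_kstar.1 hx₁
          exact Language.mem_kstar.2 ⟨w :: T, by simp, by simpa [hw] using hT⟩
  · rintro ⟨x₁, x₂, rfl, hx₁, hy⟩
    obtain ⟨z, hz, t, ht, rfl⟩ := Language.mem_mul.1 hy
    obtain ⟨S, rfl, hS⟩ := Language.mem_kstar.1 hx₁
    obtain ⟨T, rfl, hT⟩ := Language.mem_kstar.1 ht
    refine Language.mem_kstar.2 ⟨S ++ (x₂ ++ z) :: T, by simp, ?_⟩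
    intro w hw
    rcases List.mem_append.1 hw with h | h
    · exact hS w h
    · rcases List.mem_cons.1 h with rfl | h
      · exact hz
      · exact hT w h

theorem Language.IsRegular.kstar {L : Language α} (hL : L.IsRegular) :
    (KStar.kstar L).IsRegular := by
  apply Language.IsRegular.of_finite_range_leftQuotient
  refine ((hL.finite_range_leftQuotient.powerset.image
    fun 𝒬 => (⨆ Q ∈ 𝒬, Q * KStar.kstar L : Language α)).insert
      (KStar.kstar L)).subset ?_
  rintro _ ⟨x, rfl⟩
  rcases eq_or_ne x [] with rfl | hx
  · exact Or.inl rfl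
  · refine Or.inr ⟨{Q | ∃ x₁ x₂, x₁ ++ x₂ = x ∧ x₁ ∈ KStar.kstar L ∧ L.leftQuotient x₂ = Q},
      ?_, ?_⟩
    · rintro _ ⟨x₁, x₂, -, -, rfl⟩
      exact ⟨x₂, rfl⟩
    · ext y
      simp only [Language.mem_iSup, exists_prop]
      rw [Language.mem_leftQuotient, append_mem_kstar_iff hx]
      constructor
      · rintro ⟨_, ⟨x₁, x₂, h, hx₁, rfl⟩, hy⟩
        exact ⟨x₁, x₂, h, hx₁, hy⟩
      · rintro ⟨x₁, x₂, h, hx₁, hy⟩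
        exact ⟨_, ⟨x₁, x₂, h, hx₁, rfl⟩, hy⟩

end RegularLanguages

section RationalSets

/-- The rational subsets of a monoid: the closure of the finite subsets under union, product and
generated submonoid. -/
inductive IsRationalSet {M : Type*} [Monoid M] : Set M → Prop
  | empty : IsRationalSet ∅
  | singleton (m : M) : IsRationalSet {m}
  | union {S T : Set M} : IsRationalSet S → IsRationalSet T → IsRationalSet (S ∪ T)
  | mul {S T : Set M} : IsRationalSet S → IsRationalSet T → IsRationalSet (S * T)
  | star {S : Set M} : IsRationalSet S → IsRationalSet (Submonoid.closure S : Set M)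

variable {M N : Type*} [Monoid M] [Monoid N]

theorem IsRationalSet.image {S : Set M} (hS : IsRationalSet S) (φ : M →* N) :
    IsRationalSet (φ '' S) := by
  induction hS with
  | empty => simpa using IsRationalSet.empty
  | singleton m => simpa using IsRationalSet.singleton (φ m)
  | union _ _ hS hT => simpa only [Set.image_union] using hS.union hT
  | mul _ _ hS hT => simpa only [Set.image_mul] using hS.mul hT
  | @star S _ hS =>
    have := hS.star
    rwa [← MonoidHom.map_mclosure, Submonoid.coe_map] at this

theorem IsRationalSet.exists_isRegular {α : Type*} (gen : α → M)
    (hsurj : Function.Surjective fun w : List α => (w.map gen).prod) {S : Set M}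
    (hS : IsRationalSet S) :
    ∃ L : Language α, L.IsRegular ∧ (fun w : List α => (w.map gen).prod) '' L = S := by
  induction hS with
  | empty => exact ⟨(∅ : Set (List α)), isRegular_empty, Set.image_empty _⟩
  | singleton m =>
    obtain ⟨w, rfl⟩ := hsurj m
    exact ⟨({w} : Set (List α)), isRegular_singleton w, Set.image_singleton⟩
  | union _ _ hS hT =>
    obtain ⟨K, hK, rfl⟩ := hS
    obtain ⟨L, hL, rfl⟩ := hT
    exact ⟨K + L, hK.add hL, Set.image_union _ _ _⟩
  | mul _ _ hS hT =>
    obtain ⟨K, hK, rfl⟩ := hS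
    obtain ⟨L, hL, rfl⟩ := hT
    refine ⟨K * L, hK.mul hL, ?_⟩
    ext m
    constructor
    · rintro ⟨_, ⟨a, ha, b, hb, rfl⟩, rfl⟩
      exact ⟨_, ⟨a, ha, rfl⟩, _, ⟨b, hb, rfl⟩, by simp⟩
    · rintro ⟨_, ⟨a, ha, rfl⟩, _, ⟨b, hb, rfl⟩, rfl⟩
      exact ⟨a ++ b, Language.append_mem_mul ha hb, by simp⟩
  | star _ hS =>
    obtain ⟨L, hL, rfl⟩ := hS
    refine ⟨KStar.kstar L, hL.kstar, ?_⟩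
    ext m
    constructor
    · rintro ⟨_, ⟨T, rfl, hT⟩, rfl⟩
      simp only [List.map_flatten, List.prod_flatten, List.map_map]
      refine Submonoid.list_prod_mem _ fun y hy => ?_
      obtain ⟨w, hw, rfl⟩ := List.mem_map.1 hy
      exact Submonoid.subset_closure ⟨w, hT w hw, rfl⟩
    · intro hm
      induction hm using Submonoid.closure_induction with
      | mem x hx =>
        obtain ⟨w, hw, rfl⟩ := hx
        exact ⟨w, Language.mem_kstar.2 ⟨[w], by simp, fun y hy => List.mem_singleton.1 hy ▸ hw⟩,
          rfl⟩
      | one => exact ⟨[], Language.nil_mem_kstar _, rfl⟩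
      | mul x y _ _ hx hy =>
        obtain ⟨a, ha, rfl⟩ := hx
        obtain ⟨b, hb, rfl⟩ := hy
        obtain ⟨S, rfl, hS⟩ := Language.mem_kstar.1 ha
        obtain ⟨T, rfl, hT⟩ := Language.mem_kstar.1 hb
        refine ⟨S.flatten ++ T.flatten, Language.mem_kstar.2 ⟨S ++ T, by simp, ?_⟩, by simp⟩
        intro w hw
        exact (List.mem_append.1 hw).elim (hS w) (hT w)

end RationalSets

section TraceMonoid

namespace TP4

/-- The generators of `T(P_4)`. -/
abbrev gen (i : Fin 4) : TP4 := PresentedMonoid.of tracePathRel i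

theorem commute_gen (i : Fin 3) : Commute (gen i.castSucc) (gen i.succ) :=
  PresentedMonoid.mk_eq_mk_of_rel ⟨i, rfl, rfl⟩

/-- The homomorphism out of `T(P_4)` determined by the images of the four generators. -/
def lift {M : Type*} [Monoid M] (f : Fin 4 → M)
    (h : ∀ i : Fin 3, Commute (f i.castSucc) (f i.succ)) : TP4 →* M :=
  PresentedMonoid.lift f <| by
    rintro _ _ ⟨i, rfl, rfl⟩
    simpa using (h i).eq

@[simp]
theorem lift_gen {M : Type*} [Monoid M] (f : Fin 4 → M)
    (h : ∀ i : Fin 3, Commute (f i.castSucc) (f i.succ)) (i : Fin 4) : lift f h (gen i) = f i :=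
  rfl

/-- The length of a trace. -/
def length : TP4 →* Multiplicative ℕ :=
  lift (fun _ => Multiplicative.ofAdd 1) fun _ => Commute.all _ _

theorem eq_one_of_length_eq_one {x : TP4} (hx : length x = 1) : x = 1 := by
  obtain ⟨w, rfl⟩ := PresentedMonoid.surjective_mk x
  induction w using FreeMonoid.inductionOn' with
  | one => rfl
  | of_mul i w _ =>
    have h : length (gen i * PresentedMonoid.mk tracePathRel w) = 1 := hx
    rw [map_mul, length, lift_gen] at h
    have := congrArg Multiplicative.toAdd h
    simp at this

/-- If a subset generates a copy of `T(P_4)`, then it contains the generators. -/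
theorem symm_gen_mem {M : Type*} [Monoid M] {U : Set M} (e : Submonoid.closure U ≃* TP4)
    (i : Fin 4) : (e.symm (gen i) : M) ∈ U := by
  suffices h : ∀ x (hx : x ∈ Submonoid.closure U),
      length (e ⟨x, hx⟩) = Multiplicative.ofAdd 1 → x ∈ U from
    h _ (e.symm (gen i)).2 (by simp [length])
  intro x hx
  induction hx using Submonoid.closure_induction with
  | mem x hx => exact fun _ => hx
  | one =>
    intro h
    have h1 : e ⟨1, one_mem _⟩ = 1 := map_one e
    rw [h1, map_one] at h
    exact absurd (congrArg Multiplicative.toAdd h) (by simp)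
  | mul x y hx hy ihx ihy =>
    intro h
    have hmul : e ⟨x * y, mul_mem hx hy⟩ = e ⟨x, hx⟩ * e ⟨y, hy⟩ :=
      map_mul e ⟨x, hx⟩ ⟨y, hy⟩
    have of_length_zero : ∀ z (hz : z ∈ Submonoid.closure U),
        (length (e ⟨z, hz⟩)).toAdd = 0 → z = 1 := by
      intro z hz hl
      have := eq_one_of_length_eq_one (x := e ⟨z, hz⟩) (Multiplicative.toAdd.injective hl)
      exact congrArg Subtype.val ((map_eq_one_iff e e.injective).1 this)
    rw [hmul, map_mul] at h
    have hsum : (length (e ⟨x, hx⟩)).toAdd + (length (e ⟨y, hy⟩)).toAdd = 1 :=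
      congrArg Multiplicative.toAdd h
    rcases Nat.eq_zero_or_pos (length (e ⟨x, hx⟩)).toAdd with h0 | h0
    · obtain rfl := of_length_zero x hx h0
      rw [one_mul]
      exact ihy (Multiplicative.toAdd.injective (by simpa [h0] using hsum))
    · have h0' : (length (e ⟨y, hy⟩)).toAdd = 0 := by omega
      obtain rfl := of_length_zero y hy h0'
      rw [mul_one]
      exact ihx (Multiplicative.toAdd.injective (by simpa [h0'] using hsum))

/-- The projection of a trace to the letters `i` and `j`, which become `true` and `false`. -/
def proj (i j : Fin 4) (h : ∀ l : Fin 3, ¬ (i = l.castSucc ∧ j = l.succ) ∧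
    ¬ (j = l.castSucc ∧ i = l.succ)) : TP4 →* FreeMonoid Bool :=
  lift (fun l => if l = i then .of true else if l = j then .of false else 1) <| by
    intro l
    have hl : l.castSucc ≠ l.succ := l.castSucc_lt_succ.ne
    have := h l
    split_ifs <;> first | exact Commute.one_left _ | exact Commute.one_right _ | simp_all

end TP4

/-- The unary encoding of a sequence of numbers. -/
def unaryCode : FreeMonoid ℕ →* FreeMonoid Bool :=
  FreeMonoid.lift fun n => FreeMonoid.of true ^ n * FreeMonoid.of false

theorem unaryCode_injective : Function.Injective unaryCode := by
  have key : ∀ (m n : ℕ) (x y : FreeMonoid Bool),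
      FreeMonoid.of true ^ m * (FreeMonoid.of false * x) =
        FreeMonoid.of true ^ n * (FreeMonoid.of false * y) → m = n ∧ x = y := by
    intro m
    induction m with
    | zero =>
      rintro (_ | n) x y h
      · exact ⟨rfl, by simpa using h⟩
      · rw [pow_succ', mul_assoc, pow_zero, one_mul] at h
        have := congrArg (fun z => (FreeMonoid.toList z).head?) h
        simp at this
    | succ m ih =>
      rintro (_ | n) x y h
      · rw [pow_succ', mul_assoc, pow_zero, one_mul] at h
        have := congrArg (fun z => (FreeMonoid.toList z).head?) h
        simp at this
      · rw [pow_succ', pow_succ', mul_assoc, mul_assoc] at h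
        have := ih n x y (mul_left_cancel h)
        exact ⟨by rw [this.1], this.2⟩
  have ne_one : ∀ (n : ℕ) (x : FreeMonoid Bool),
      FreeMonoid.of true ^ n * (FreeMonoid.of false * x) ≠ 1 := by
    intro n x h
    have := congrArg (fun z => (FreeMonoid.toList z).length) h
    simp at this
  intro v
  induction v using FreeMonoid.inductionOn' with
  | one =>
    intro w h
    cases w using FreeMonoid.casesOn with
    | one => rfl
    | of_mul n w =>
      rw [map_mul, map_one, unaryCode, FreeMonoid.lift_eval_of, mul_assoc] at h
      exact (ne_one _ _ h.symm).elim
  | of_mul m v ih =>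
    intro w h
    cases w using FreeMonoid.casesOn with
    | one =>
      rw [map_mul, map_one, unaryCode, FreeMonoid.lift_eval_of, mul_assoc] at h
      exact (ne_one _ _ h).elim
    | of_mul n w =>
      have hcode : ∀ (k : ℕ) (z : FreeMonoid ℕ), unaryCode (.of k * z) =
          FreeMonoid.of true ^ k * (FreeMonoid.of false * unaryCode z) := by
        intro k z
        simp [unaryCode, mul_assoc]
      rw [hcode, hcode] at h
      obtain ⟨rfl, h'⟩ := key _ _ _ _ h
      rw [ih h']

end TraceMonoid

section Transitions

namespace TP4

/-- The trace recording the transitions `n ↦ m` of a run, one after the other. -/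
def transitionTrace : FreeMonoid (ℕ × ℕ) →* TP4 :=
  FreeMonoid.lift fun p => gen 2 ^ p.1 * gen 1 ^ p.2 * (gen 0 * gen 3)

/-- The trace recording the successors of the given numbers twice. -/
def copyTrace : FreeMonoid ℕ →* TP4 :=
  FreeMonoid.lift fun k => (gen 1 * gen 2) ^ k * (gen 1 * gen 2 * gen 3 * gen 0)

/-- The trace of a single configuration. -/
def configTrace (n : ℕ) : TP4 := gen 1 ^ n * gen 3

end TP4

/-- `IsRun l x y` says that the transitions in `l` lead from `x` to `y`. -/
def IsRun (l : FreeMonoid (ℕ × ℕ)) (x y : ℕ) : Prop :=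
  FreeMonoid.map Prod.fst l * FreeMonoid.of y = FreeMonoid.of x * FreeMonoid.map Prod.snd l

theorem isRun_one {x y : ℕ} : IsRun 1 x y ↔ x = y := by
  simp [IsRun, eq_comm, FreeMonoid.of_injective.eq_iff]

theorem isRun_of_mul {p : ℕ × ℕ} {l : FreeMonoid (ℕ × ℕ)} {x y : ℕ} :
    IsRun (FreeMonoid.of p * l) x y ↔ x = p.1 ∧ IsRun l p.2 y := by
  simp only [IsRun, map_mul, FreeMonoid.map_of, mul_assoc]
  constructor
  · intro h
    have h' := congrArg FreeMonoid.toList h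
    simp only [FreeMonoid.toList_of_mul, List.cons.injEq] at h'
    exact ⟨h'.1.symm, FreeMonoid.toList.injective (by simpa using h'.2)⟩
  · rintro ⟨rfl, h⟩
    rw [h]

theorem isRun_mul {k l : FreeMonoid (ℕ × ℕ)} {x z : ℕ} :
    IsRun (k * l) x z ↔ ∃ y, IsRun k x y ∧ IsRun l y z := by
  induction k using FreeMonoid.inductionOn' generalizing x with
  | one => simp [isRun_one]
  | of_mul p k ih => simp [mul_assoc, isRun_of_mul, ih, and_assoc]

theorem isRun_of {p : ℕ × ℕ} {x y : ℕ} : IsRun (FreeMonoid.of p) x y ↔ x = p.1 ∧ y = p.2 := by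
  rw [← mul_one (FreeMonoid.of p), isRun_of_mul, isRun_one, eq_comm (a := y)]

theorem TP4.copyTrace_mul_configTrace_eq_iff {ks : FreeMonoid ℕ} {l : FreeMonoid (ℕ × ℕ)}
    {x y : ℕ} :
    copyTrace ks * configTrace y = configTrace x * transitionTrace l ↔
      IsRun l x y ∧ FreeMonoid.map Prod.fst l = FreeMonoid.map Nat.succ ks := by
  have h21 : Commute (gen 2) (gen 1) := (commute_gen 1).symm
  have h23 : Commute (gen 2) (gen 3) := commute_gen 2
  have h10 : Commute (gen 1) (gen 0) := (commute_gen 0).symm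
  constructor
  · intro h
    have hab := congrArg (proj 2 0 (by decide)) h
    have hdc := congrArg (proj 1 3 (by decide)) h
    have hab_config : ∀ n, proj 2 0 (by decide) (configTrace n) = 1 := by
      intro n
      simp [configTrace, proj]
    have hab_copy : (proj 2 0 (by decide)).comp copyTrace =
        unaryCode.comp (FreeMonoid.map Nat.succ) := by
      ext k
      simp [copyTrace, proj, unaryCode, pow_succ, mul_assoc]
    have hab_trans : (proj 2 0 (by decide)).comp transitionTrace =
        unaryCode.comp (FreeMonoid.map Prod.fst) := by
      ext p
      simp [transitionTrace, proj, unaryCode]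
    have hdc_config : ∀ n, proj 1 3 (by decide) (configTrace n) = unaryCode (.of n) := by
      intro n
      simp [configTrace, proj, unaryCode]
    have hdc_copy : (proj 1 3 (by decide)).comp copyTrace =
        unaryCode.comp (FreeMonoid.map Nat.succ) := by
      ext k
      simp [copyTrace, proj, unaryCode, pow_succ, mul_assoc]
    have hdc_trans : (proj 1 3 (by decide)).comp transitionTrace =
        unaryCode.comp (FreeMonoid.map Prod.snd) := by
      ext p
      simp [transitionTrace, proj, unaryCode]
    rw [map_mul, map_mul, hab_config, hab_config, mul_one, one_mul] at hab
    rw [map_mul, map_mul, hdc_config, hdc_config] at hdc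
    have hfst := (DFunLike.congr_fun hab_copy ks).symm.trans
      (hab.trans (DFunLike.congr_fun hab_trans l))
    have hsnd : unaryCode (FreeMonoid.map Nat.succ ks * .of y) =
        unaryCode (.of x * FreeMonoid.map Prod.snd l) := by
      rw [map_mul, map_mul, ← MonoidHom.comp_apply, ← hdc_copy, MonoidHom.comp_apply, hdc,
        ← MonoidHom.comp_apply, hdc_trans, MonoidHom.comp_apply]
    have hfst' := unaryCode_injective hfst
    refine ⟨?_, hfst'.symm⟩
    rw [IsRun, ← hfst']
    exact unaryCode_injective hsnd
  · rintro ⟨hrun, hks⟩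
    induction l using FreeMonoid.inductionOn' generalizing x ks with
    | one =>
      cases ks using FreeMonoid.casesOn with
      | one => simp [isRun_one.1 hrun]
      | of_mul k ks => exact absurd (congrArg FreeMonoid.length hks) (by simp; omega)
    | of_mul p l ih =>
      cases ks using FreeMonoid.casesOn with
      | one => exact absurd (congrArg FreeMonoid.length hks) (by simp)
      | of_mul k ks =>
        rw [isRun_of_mul] at hrun
        obtain ⟨rfl, hrun⟩ := hrun
        have hks' := congrArg FreeMonoid.toList hks
        simp only [map_mul, FreeMonoid.map_of, FreeMonoid.toList_of_mul, List.cons.injEq] at hks'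
        have hrec := ih hrun (FreeMonoid.toList.injective hks'.2)
        obtain ⟨n, m⟩ := p
        obtain rfl : n = k + 1 := hks'.1
        dsimp only at hrec
        have hcopy : copyTrace (.of k) = gen 1 ^ (k + 1) * gen 2 ^ (k + 1) * gen 3 * gen 0 := by
          rw [← h21.symm.mul_pow, pow_succ]
          simp [copyTrace, mul_assoc]
        have htrans : transitionTrace (.of (k + 1, m)) =
            gen 2 ^ (k + 1) * gen 1 ^ m * (gen 0 * gen 3) := by
          simp [transitionTrace]
        have h1 : gen 3 * gen 2 ^ (k + 1) = gen 2 ^ (k + 1) * gen 3 := (h23.pow_left _).eq.symm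
        have h2 : gen 1 ^ m * gen 0 = gen 0 * gen 1 ^ m := (h10.pow_left _).eq
        calc copyTrace (.of k * ks) * configTrace y
            = gen 1 ^ (k + 1) * (gen 2 ^ (k + 1) * gen 3) * (gen 0 * gen 1 ^ m) * gen 3 *
                transitionTrace l := by
              rw [map_mul, mul_assoc, hrec, hcopy, configTrace]
              simp only [mul_assoc]
          _ = _ := by
              rw [← h1, ← h2, map_mul, htrans, configTrace]
              simp only [mul_assoc]

/-- The numbers from which transitions are made are positive. -/
def positiveRuns : Submonoid (FreeMonoid (ℕ × ℕ)) :=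
  (MonoidHom.mrange (FreeMonoid.map Nat.succ)).comap (FreeMonoid.map Prod.fst)

/-- A relation on `ℕ` is a rational transition if it is realised by the runs in a set of
transition sequences whose traces form a rational set. -/
def IsRationalTransition (R : ℕ → ℕ → Prop) : Prop :=
  ∃ E : Set (FreeMonoid (ℕ × ℕ)), IsRationalSet (TP4.transitionTrace '' E) ∧
    E ⊆ positiveRuns ∧ ∀ x y, R x y ↔ ∃ l ∈ E, IsRun l x y

namespace IsRationalTransition

variable {R S : ℕ → ℕ → Prop}

theorem progression (x y p q : ℕ) :
    IsRationalTransition fun u v => ∃ t, u = x + 1 + p * t ∧ v = y + q * t := by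
  refine ⟨Set.range fun t => FreeMonoid.of (x + 1 + p * t, y + q * t), ?_, ?_, ?_⟩
  · have h : IsRationalSet (({TP4.gen 2 ^ (x + 1) * TP4.gen 1 ^ y} : Set TP4) *
        (Submonoid.closure {TP4.gen 2 ^ p * TP4.gen 1 ^ q} : Set TP4) *
          {TP4.gen 0 * TP4.gen 3}) :=
      ((IsRationalSet.singleton _).mul (IsRationalSet.singleton _).star).mul
        (IsRationalSet.singleton _)
    convert h using 1
    have h21 : Commute (TP4.gen 2) (TP4.gen 1) := (TP4.commute_gen 1).symm
    have key : ∀ t, TP4.transitionTrace (.of (x + 1 + p * t, y + q * t)) =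
        TP4.gen 2 ^ (x + 1) * TP4.gen 1 ^ y * (TP4.gen 2 ^ p * TP4.gen 1 ^ q) ^ t *
          (TP4.gen 0 * TP4.gen 3) := by
      intro t
      rw [(h21.pow_pow p q).mul_pow, ← pow_mul, ← pow_mul, mul_assoc (TP4.gen 2 ^ (x + 1)),
        ← mul_assoc (TP4.gen 1 ^ y), ← (h21.pow_pow (p * t) y).eq]
      simp [TP4.transitionTrace, pow_add, mul_assoc]
    ext z
    constructor
    · rintro ⟨_, ⟨t, rfl⟩, rfl⟩
      rw [key]
      exact Set.mul_mem_mul (Set.mul_mem_mul (Set.mem_singleton _)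
        (pow_mem (Submonoid.subset_closure (Set.mem_singleton _)) t)) (Set.mem_singleton _)
    · rintro ⟨_, ⟨_, rfl, w, hw, rfl⟩, _, rfl, rfl⟩
      obtain ⟨t, rfl⟩ := Submonoid.mem_closure_singleton.1 hw
      exact ⟨_, ⟨t, rfl⟩, key t⟩
  · rintro _ ⟨t, rfl⟩
    exact ⟨.of (x + p * t), by simp [Nat.add_right_comm]⟩
  · intro u v
    simp [isRun_of]

theorem id : IsRationalTransition (· = ·) :=
  ⟨{1}, by simpa using IsRationalSet.singleton 1, Set.singleton_subset_iff.2 (one_mem _),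
    by simp [isRun_one]⟩

theorem empty : IsRationalTransition fun _ _ => False :=
  ⟨∅, by simpa using IsRationalSet.empty, by simp, by simp⟩

theorem union (hR : IsRationalTransition R) (hS : IsRationalTransition S) :
    IsRationalTransition fun x y => R x y ∨ S x y := by
  obtain ⟨E, hE, hE', hE''⟩ := hR
  obtain ⟨F, hF, hF', hF''⟩ := hS
  refine ⟨E ∪ F, by simpa only [Set.image_union] using hE.union hF, Set.union_subset hE' hF', ?_⟩
  intro x y
  simp only [hE'', hF'', Set.mem_union, or_and_right, exists_or]

theorem comp (hR : IsRationalTransition R) (hS : IsRationalTransition S) :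
    IsRationalTransition (Relation.Comp R S) := by
  obtain ⟨E, hE, hE', hE''⟩ := hR
  obtain ⟨F, hF, hF', hF''⟩ := hS
  refine ⟨E * F, by simpa only [Set.image_mul] using hE.mul hF, ?_, ?_⟩
  · rintro _ ⟨k, hk, l, hl, rfl⟩
    exact mul_mem (hE' hk) (hF' hl)
  · intro x z
    constructor
    · rintro ⟨y, hxy, hyz⟩
      obtain ⟨k, hk, hk'⟩ := (hE'' _ _).1 hxy
      obtain ⟨l, hl, hl'⟩ := (hF'' _ _).1 hyz
      exact ⟨k * l, Set.mul_mem_mul hk hl, isRun_mul.2 ⟨y, hk', hl'⟩⟩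
    · rintro ⟨_, ⟨k, hk, l, hl, rfl⟩, h⟩
      obtain ⟨y, hk', hl'⟩ := isRun_mul.1 h
      exact ⟨y, (hE'' _ _).2 ⟨k, hk, hk'⟩, (hF'' _ _).2 ⟨l, hl, hl'⟩⟩

theorem star (hR : IsRationalTransition R) :
    IsRationalTransition (Relation.ReflTransGen R) := by
  obtain ⟨E, hE, hE', hE''⟩ := hR
  refine ⟨Submonoid.closure E, ?_, Submonoid.closure_le.2 hE', ?_⟩
  · have := hE.star
    rwa [← MonoidHom.map_mclosure, Submonoid.coe_map] at this
  · intro x z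
    constructor
    · intro h
      induction h with
      | refl => exact ⟨1, one_mem _, isRun_one.2 rfl⟩
      | tail _ hyz ih =>
        obtain ⟨k, hk, hk'⟩ := ih
        obtain ⟨l, hl, hl'⟩ := (hE'' _ _).1 hyz
        exact ⟨k * l, mul_mem hk (Submonoid.subset_closure hl), isRun_mul.2 ⟨_, hk', hl'⟩⟩
    · rintro ⟨l, hl, hxz⟩
      induction hl using Submonoid.closure_induction generalizing x z with
      | mem l hl => exact .single ((hE'' _ _).2 ⟨l, hl, hxz⟩)
      | one => rw [isRun_one.1 hxz]
      | mul k l _ _ ihk ihl =>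
        obtain ⟨y, hk, hl⟩ := isRun_mul.1 hxz
        exact (ihk _ _ hk).trans (ihl _ _ hl)

end IsRationalTransition

end Transitions

section LeftDeletion

variable {M : Type*} [Monoid M] {φ : TP4 →* M}

theorem copyTrace_mul_gen_one (ks : FreeMonoid ℕ) (x : M) :
    ∃ y, φ (TP4.copyTrace ks) * (φ (TP4.gen 1) * x) = φ (TP4.gen 1) * y := by
  cases ks using FreeMonoid.casesOn with
  | one => exact ⟨x, by simp⟩
  | of_mul k ks =>
    refine ⟨φ (TP4.gen 2) * (φ (TP4.gen 1) * φ (TP4.gen 2)) ^ k * φ (TP4.gen 3) *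
      φ (TP4.gen 0) * φ (TP4.copyTrace ks) * (φ (TP4.gen 1) * x), ?_⟩
    simp only [map_mul, TP4.copyTrace, FreeMonoid.lift_eval_of, map_pow]
    simp only [← mul_assoc]
    rw [mul_assoc _ (φ (TP4.gen 1)) (φ (TP4.gen 2)), ← pow_succ, ← pow_succ']

/-- Left deletion of the traces `copyTrace ks` is given by a rational set. -/
theorem exists_rational_left_deletion
    (hdel : ∀ i j : Fin 4, ∃ m : M, m * (φ (TP4.gen i) * φ (TP4.gen j)) = φ (TP4.gen j)) :
    ∃ D : Set M, IsRationalSet D ∧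
      (∀ δ ∈ D, ∃ ks, ∀ x, δ * (φ (TP4.copyTrace ks) * (φ (TP4.gen 1) * x)) =
        φ (TP4.gen 1) * x) ∧
      ∀ ks, ∃ δ ∈ D, ∀ x, δ * (φ (TP4.copyTrace ks) * (φ (TP4.gen 1) * x)) =
        φ (TP4.gen 1) * x := by
  have hdel' : ∀ i j : Fin 4, ∃ m : M, ∀ x,
      m * (φ (TP4.gen i) * (φ (TP4.gen j) * x)) = φ (TP4.gen j) * x := by
    intro i j
    obtain ⟨m, hm⟩ := hdel i j
    exact ⟨m, fun x => by rw [← mul_assoc (φ _), ← mul_assoc, hm]⟩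
  obtain ⟨m₀₁, h₀₁⟩ := hdel' 0 1
  obtain ⟨m₃₀, h₃₀⟩ := hdel' 3 0
  obtain ⟨m₂₃, h₂₃⟩ := hdel' 2 3
  obtain ⟨m₁₂, h₁₂⟩ := hdel' 1 2
  obtain ⟨m₂₁, h₂₁⟩ := hdel' 2 1
  set Y := m₂₁ * m₁₂
  set Z := m₀₁ * m₃₀ * m₂₃ * m₁₂
  have hY : ∀ (k : ℕ) x, Y ^ k * ((φ (TP4.gen 1) * φ (TP4.gen 2)) ^ k * (φ (TP4.gen 1) * x)) =
      φ (TP4.gen 1) * x := by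
    intro k
    induction k with
    | zero => simp
    | succ k ih =>
      intro x
      have h : (φ (TP4.gen 1) * φ (TP4.gen 2)) ^ (k + 1) * (φ (TP4.gen 1) * x) =
          (φ (TP4.gen 1) * φ (TP4.gen 2)) ^ k *
            (φ (TP4.gen 1) * (φ (TP4.gen 2) * (φ (TP4.gen 1) * x))) := by
        simp only [pow_succ, mul_assoc]
      rw [h, pow_succ', mul_assoc Y, ih, mul_assoc, h₁₂, h₂₁]
  have hZ : ∀ (k : ℕ) x, Z * Y ^ k * (φ (TP4.copyTrace (.of k)) * (φ (TP4.gen 1) * x)) =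
      φ (TP4.gen 1) * x := by
    intro k x
    simp only [TP4.copyTrace, FreeMonoid.lift_eval_of, map_mul, map_pow, mul_assoc]
    rw [hY]
    simp only [Z, mul_assoc, h₁₂, h₂₃, h₃₀, h₀₁]
  have hmul : ∀ {δ₁ δ₂ : M} {ks₁ ks₂ : FreeMonoid ℕ},
      (∀ x, δ₁ * (φ (TP4.copyTrace ks₁) * (φ (TP4.gen 1) * x)) = φ (TP4.gen 1) * x) →
      (∀ x, δ₂ * (φ (TP4.copyTrace ks₂) * (φ (TP4.gen 1) * x)) = φ (TP4.gen 1) * x) →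
      ∀ x, δ₁ * δ₂ * (φ (TP4.copyTrace (ks₂ * ks₁)) * (φ (TP4.gen 1) * x)) =
        φ (TP4.gen 1) * x := by
    intro δ₁ δ₂ ks₁ ks₂ h₁ h₂ x
    obtain ⟨y, hy⟩ := copyTrace_mul_gen_one (φ := φ) ks₁ x
    rw [map_mul, map_mul, mul_assoc, mul_assoc (φ _), hy, h₂, ← hy, h₁]
  refine ⟨Submonoid.closure ({Z} * (Submonoid.closure {Y} : Set M)),
    ((IsRationalSet.singleton _).mul (IsRationalSet.singleton _).star).star, ?_, ?_⟩
  · intro δ hδ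
    induction hδ using Submonoid.closure_induction with
    | mem δ hδ =>
      obtain ⟨_, rfl, y, hy, rfl⟩ := hδ
      obtain ⟨k, rfl⟩ := Submonoid.mem_closure_singleton.1 hy
      exact ⟨.of k, hZ k⟩
    | one => exact ⟨1, by simp⟩
    | mul δ₁ δ₂ _ _ h₁ h₂ =>
      obtain ⟨ks₁, h₁⟩ := h₁
      obtain ⟨ks₂, h₂⟩ := h₂
      exact ⟨ks₂ * ks₁, hmul h₁ h₂⟩
  · intro ks
    induction ks using FreeMonoid.inductionOn' with
    | one => exact ⟨1, one_mem _, by simp⟩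
    | of_mul k ks ih =>
      obtain ⟨δ, hδ, h⟩ := ih
      refine ⟨δ * (Z * Y ^ k), mul_mem hδ (Submonoid.subset_closure ?_), hmul h (hZ k)⟩
      exact Set.mul_mem_mul (Set.mem_singleton _)
        (pow_mem (Submonoid.subset_closure (Set.mem_singleton _)) k)

/-- A rational transition relation is decoded by membership in a rational subset. -/
theorem IsRationalTransition.exists_rational_set {R : ℕ → ℕ → Prop}
    (hR : IsRationalTransition R) (hcancel : ∀ x y z : M, x * y = x * z → y = z)
    (hφ : Function.Injective φ)
    (hdel : ∀ i j : Fin 4, ∃ m : M, m * (φ (TP4.gen i) * φ (TP4.gen j)) = φ (TP4.gen j))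
    (x : ℕ) :
    ∃ S : Set M, IsRationalSet S ∧ ∀ y, φ (TP4.configTrace (y + 1)) ∈ S ↔ R x (y + 1) := by
  obtain ⟨E, hE, hpos, hRE⟩ := hR
  obtain ⟨D, hD, hdel₁, hdel₂⟩ := exists_rational_left_deletion hdel
  refine ⟨D * φ '' ({TP4.configTrace x} * TP4.transitionTrace '' E),
    hD.mul (((IsRationalSet.singleton _).mul hE).image φ), fun y => ?_⟩
  have hy : φ (TP4.configTrace (y + 1)) = φ (TP4.gen 1) * φ (TP4.configTrace y) := by
    rw [TP4.configTrace, pow_succ', mul_assoc, map_mul, TP4.configTrace]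
  rw [hRE]
  constructor
  · rintro ⟨δ, hδ, _, ⟨_, ⟨_, rfl, _, ⟨l, hl, rfl⟩, rfl⟩, rfl⟩, h⟩
    obtain ⟨ks, hks⟩ := hdel₁ δ hδ
    have h' := hcancel _ _ _ (h.trans (hy.trans (hks _).symm))
    rw [← hy, ← map_mul] at h'
    exact ⟨l, hl, (TP4.copyTrace_mul_configTrace_eq_iff.1 (hφ h').symm).1⟩
  · rintro ⟨l, hl, hrun⟩
    obtain ⟨ks, hks⟩ := hpos hl
    obtain ⟨δ, hδ, hδks⟩ := hdel₂ ks
    refine ⟨δ, hδ, φ (TP4.configTrace x * TP4.transitionTrace l),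
      ⟨_, Set.mul_mem_mul (Set.mem_singleton _) ⟨l, hl, rfl⟩, rfl⟩, ?_⟩
    rw [← TP4.copyTrace_mul_configTrace_eq_iff.2 ⟨hrun, hks.symm⟩, map_mul, hy]
    exact hδks _

end LeftDeletion

section StorePrograms

open Finsupp Relation

/-- The relations between stores computed by nondeterministic counter programs. -/
inductive IsStoreProgram : ((ℕ →₀ ℕ) → (ℕ →₀ ℕ) → Prop) → Prop
  | inc (i : ℕ) : IsStoreProgram fun s t => t = s + single i 1
  | dec (i : ℕ) : IsStoreProgram fun s t => s = t + single i 1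
  | isZero (i : ℕ) : IsStoreProgram fun s t => s i = 0 ∧ s = t
  | skip : IsStoreProgram Eq
  | comp {P Q} : IsStoreProgram P → IsStoreProgram Q → IsStoreProgram (Comp P Q)
  | star {P} : IsStoreProgram P → IsStoreProgram (ReflTransGen P)

/-- The Gödel number of a store. -/
noncomputable def storeCode (s : ℕ →₀ ℕ) : ℕ :=
  s.prod fun i k => Nat.nth Nat.Prime i ^ k

theorem storeCode_add (s t : ℕ →₀ ℕ) : storeCode (s + t) = storeCode s * storeCode t :=
  Finsupp.prod_add_index' (fun _ => pow_zero _) fun _ _ _ => pow_add _ _ _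

theorem storeCode_single (i k : ℕ) : storeCode (single i k) = Nat.nth Nat.Prime i ^ k :=
  Finsupp.prod_single_index (pow_zero _)

theorem storeCode_pos (s : ℕ →₀ ℕ) : 0 < storeCode s :=
  Finset.prod_pos fun i _ => pow_pos (Nat.prime_nth_prime i).pos _

theorem nth_prime_dvd_storeCode {s : ℕ →₀ ℕ} {i : ℕ} :
    Nat.nth Nat.Prime i ∣ storeCode s ↔ s i ≠ 0 := by
  constructor
  · intro h
    obtain ⟨j, hj, hij⟩ := ((Nat.prime_nth_prime i).prime.dvd_finsetProd_iff _).1 h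
    have := (Nat.prime_dvd_prime_iff_eq (Nat.prime_nth_prime i) (Nat.prime_nth_prime j)).1
      ((Nat.prime_nth_prime i).dvd_of_dvd_pow hij)
    rw [Nat.nth_injective Nat.infinite_setOfPred_prime this]
    exact mem_support_iff.1 hj
  · intro h
    exact (dvd_pow_self _ h).trans (Finset.dvd_prod_of_mem _ (mem_support_iff.2 h))

theorem IsRationalTransition.not_dvd {p : ℕ} (hp : 0 < p) :
    IsRationalTransition fun u v => ¬ p ∣ u ∧ u = v := by
  have key : ∀ n, n ≤ p - 1 →
      IsRationalTransition fun u v => ∃ r < n, ∃ t, u = r + 1 + p * t ∧ v = r + 1 + p * t := by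
    intro n
    induction n with
    | zero => simpa using IsRationalTransition.empty
    | succ n ih =>
      intro hn
      convert (ih (by omega)).union (IsRationalTransition.progression n (n + 1) p p) using 3
      simp only [Nat.lt_succ_iff_lt_or_eq, or_and_right, exists_or, exists_eq_left]
  convert key (p - 1) le_rfl using 3 with u v
  constructor
  · rintro ⟨h, rfl⟩
    have h0 : u % p ≠ 0 := fun h0 => h (Nat.dvd_of_mod_eq_zero h0)
    have := Nat.mod_lt u hp
    have := Nat.mod_add_div u p
    exact ⟨u % p - 1, by omega, u / p, by omega, by omega⟩
  · rintro ⟨r, hr, t, rfl, rfl⟩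
    refine ⟨fun h => ?_, rfl⟩
    have := Nat.le_of_dvd (Nat.succ_pos r) ((Nat.dvd_add_left (dvd_mul_right p t)).1 h)
    omega

/-- Counter programs are simulated by rational transitions between Gödel numbers. -/
theorem IsStoreProgram.exists_isRationalTransition {P : (ℕ →₀ ℕ) → (ℕ →₀ ℕ) → Prop}
    (hP : IsStoreProgram P) :
    ∃ R, IsRationalTransition R ∧ ∀ s v, R (storeCode s) v ↔ ∃ t, v = storeCode t ∧ P s t := by
  induction hP with
  | inc i =>
    refine ⟨_, IsRationalTransition.progression 0 (Nat.nth Nat.Prime i) 1 (Nat.nth Nat.Prime i),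
      fun s v => ?_⟩
    simp only [exists_eq_right, storeCode_add, storeCode_single, pow_one]
    constructor
    · rintro ⟨t, hs, rfl⟩
      rw [hs]
      ring
    · rintro rfl
      obtain ⟨t, ht⟩ := Nat.exists_eq_succ_of_ne_zero (storeCode_pos s).ne'
      exact ⟨t, by omega, by rw [ht, Nat.succ_eq_add_one]; ring⟩
  | dec i =>
    have hp := (Nat.prime_nth_prime i).pos
    refine ⟨_, IsRationalTransition.progression (Nat.nth Nat.Prime i - 1) 1
      (Nat.nth Nat.Prime i) 1, fun s v => ?_⟩
    rw [Nat.sub_add_cancel hp]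
    constructor
    · rintro ⟨k, hs, rfl⟩
      have hi : s i ≠ 0 := nth_prime_dvd_storeCode.1 ⟨1 + k, by rw [hs]; ring⟩
      have hst : s = s - single i 1 + single i 1 :=
        (tsub_add_cancel_of_le (single_le_iff.2 (Nat.one_le_iff_ne_zero.2 hi))).symm
      refine ⟨s - single i 1, ?_, hst⟩
      rw [hst, storeCode_add, storeCode_single, pow_one] at hs
      refine Nat.eq_of_mul_eq_mul_right hp ?_
      rw [hs]
      ring
    · rintro ⟨t, rfl, rfl⟩
      obtain ⟨k, hk⟩ := Nat.exists_eq_succ_of_ne_zero (storeCode_pos t).ne'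
      refine ⟨k, ?_, by omega⟩
      rw [storeCode_add, storeCode_single, hk, Nat.succ_eq_add_one]
      ring
  | isZero i =>
    refine ⟨_, IsRationalTransition.not_dvd (Nat.prime_nth_prime i).pos, fun s v => ?_⟩
    simp only [nth_prime_dvd_storeCode, not_not]
    constructor
    · rintro ⟨h, rfl⟩
      exact ⟨s, rfl, h, rfl⟩
    · rintro ⟨_, rfl, h, rfl⟩
      exact ⟨h, rfl⟩
  | skip => exact ⟨_, IsRationalTransition.id, fun s v => by simp [eq_comm]⟩
  | comp _ _ hP hQ =>
    obtain ⟨R, hR, hRP⟩ := hP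
    obtain ⟨S, hS, hSQ⟩ := hQ
    refine ⟨_, hR.comp hS, fun s v => ?_⟩
    constructor
    · rintro ⟨u, hu, hv⟩
      obtain ⟨t, rfl, ht⟩ := (hRP _ _).1 hu
      obtain ⟨t', rfl, ht'⟩ := (hSQ _ _).1 hv
      exact ⟨t', rfl, t, ht, ht'⟩
    · rintro ⟨t', rfl, t, ht, ht'⟩
      exact ⟨_, (hRP _ _).2 ⟨t, rfl, ht⟩, (hSQ _ _).2 ⟨t', rfl, ht'⟩⟩
  | star _ hP =>
    obtain ⟨R, hR, hRP⟩ := hP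
    refine ⟨_, hR.star, fun s v => ?_⟩
    constructor
    · intro h
      induction h with
      | refl => exact ⟨s, rfl, .refl⟩
      | tail _ h ih =>
        obtain ⟨t, rfl, ht⟩ := ih
        obtain ⟨t', rfl, ht'⟩ := (hRP _ _).1 h
        exact ⟨t', rfl, ht.tail ht'⟩
    · rintro ⟨t, rfl, ht⟩
      exact ht.lift storeCode fun a b hab => (hRP _ _).2 ⟨b, rfl, hab⟩

/-- On input `s`, the program `P` has `r` as its only result. -/
def Yields (P : (ℕ →₀ ℕ) → (ℕ →₀ ℕ) → Prop) (s r : ℕ →₀ ℕ) : Prop :=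
  ∀ t, P s t ↔ t = r

/-- Repeat `B` while counting down the register `c`. -/
def loop (c : ℕ) (B : (ℕ →₀ ℕ) → (ℕ →₀ ℕ) → Prop) : (ℕ →₀ ℕ) → (ℕ →₀ ℕ) → Prop :=
  Comp (ReflTransGen (Comp (fun s t => s = t + single c 1) B)) fun s t => s c = 0 ∧ s = t

variable {B P Q : (ℕ →₀ ℕ) → (ℕ →₀ ℕ) → Prop}

theorem IsStoreProgram.loop (c : ℕ) (hB : IsStoreProgram B) : IsStoreProgram (loop c B) :=
  ((IsStoreProgram.dec c).comp hB).star.comp (.isZero c)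

theorem Yields.comp {s s' s'' : ℕ →₀ ℕ} (hP : Yields P s s') (hQ : Yields Q s' s'') :
    Yields (Comp P Q) s s'' := by
  intro t
  constructor
  · rintro ⟨u, hu, ht⟩
    rw [(hP u).1 hu] at ht
    exact (hQ t).1 ht
  · rintro rfl
    exact ⟨s', (hP _).2 rfl, (hQ _).2 rfl⟩

theorem yields_skip (s : ℕ →₀ ℕ) : Yields Eq s s := fun _ => eq_comm

theorem yields_inc (s : ℕ →₀ ℕ) (i : ℕ) :
    Yields (fun s t => t = s + single i 1) s (s + single i 1) :=
  fun _ => Iff.rfl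

theorem yields_loop {c : ℕ} (σ : ℕ → ℕ →₀ ℕ) (hc : ∀ j, σ j c = 0)
    (hB : ∀ j k, Yields B (σ j + single c k) (σ (j + 1) + single c k)) (n j : ℕ) :
    Yields (loop c B) (σ j + single c n) (σ (j + n)) := by
  induction n generalizing j with
  | zero =>
    intro t
    rw [single_zero, add_zero, add_zero]
    constructor
    · rintro ⟨u, hu, -, rfl⟩
      rcases hu.cases_head with h | ⟨v, ⟨w, hw, -⟩, -⟩
      · exact h.symm
      · have := DFunLike.congr_fun hw c
        simp [hc] at this
    · rintro rfl
      exact ⟨_, .refl, hc j, rfl⟩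
  | succ n ih =>
    intro t
    rw [show j + (n + 1) = j + 1 + n by omega, ← ih (j + 1) t]
    have hdec : σ j + single c (n + 1) = σ j + single c n + single c 1 := by
      rw [single_add, add_assoc]
    constructor
    · rintro ⟨u, hu, hu0, rfl⟩
      rcases hu.cases_head with rfl | ⟨v, ⟨w, hw, hwv⟩, h⟩
      · simp at hu0
      · rw [hdec] at hw
        rw [← add_right_cancel hw, hB j n] at hwv
        rw [hwv] at h
        exact ⟨u, h, hu0, rfl⟩
    · rintro ⟨u, hu, hu0, rfl⟩
      exact ⟨u, hu.head ⟨_, hdec, (hB j n _).2 rfl⟩, hu0, rfl⟩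

theorem exists_clear (c : ℕ) : ∃ P, IsStoreProgram P ∧
    ∀ (r : ℕ →₀ ℕ) n, r c = 0 → Yields P (r + single c n) r :=
  ⟨_, IsStoreProgram.skip.loop c, fun r n hr =>
    yields_loop (fun _ => r) (fun _ => hr) (fun _ _ => yields_skip _) n 0⟩

theorem exists_move {c o : ℕ} (hco : c ≠ o) : ∃ P, IsStoreProgram P ∧
    ∀ (r : ℕ →₀ ℕ) n, r c = 0 → Yields P (r + single c n) (r + single o n) := by
  refine ⟨_, (IsStoreProgram.inc o).loop c, fun r n hr => ?_⟩
  have := yields_loop (c := c) (B := fun s t => t = s + single o 1) (fun j => r + single o j)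
    (by simp [hr, hco]) ?_ n 0
  · simpa using this
  · intro j k
    convert yields_inc _ o using 1
    rw [single_add]
    abel

theorem exists_copy {c o tmp : ℕ} (hco : c ≠ o) (hct : c ≠ tmp) (hot : o ≠ tmp) :
    ∃ P, IsStoreProgram P ∧
      ∀ s : ℕ →₀ ℕ, s tmp = 0 → Yields P s (s + single o (s c)) := by
  obtain ⟨Q, hQ, hQ'⟩ := exists_move hct.symm
  refine ⟨_, (((IsStoreProgram.inc o).comp (.inc tmp)).loop c).comp hQ, fun s hs => ?_⟩
  have hs' : s.erase c + single c (s c) = s := erase_add_single c s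
  have hloop := yields_loop (c := c)
    (B := Comp (fun s t => t = s + single o 1) (fun s t => t = s + single tmp 1))
    (fun j => s.erase c + single o j + single tmp j) (by simp [hco, hct]) ?_ (s c) 0
  · simp only [single_zero, add_zero, zero_add, hs'] at hloop
    convert hloop.comp (hQ' _ (s c) (by simp [hs, hot, hct.symm])) using 1
    conv_lhs => rw [← hs']
    abel_nf
    simp
  · intro j k
    convert (yields_inc _ o).comp (yields_inc _ tmp) using 1
    rw [single_add, single_add]
    abel

/-- Primitive recursive functions are computed by counter programs: the value of `f` at the
registers `xs` is added to the register `o`, using scratch registers from `b` on. -/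
theorem Nat.Primrec'.exists_isStoreProgram {n : ℕ} {f : List.Vector ℕ n → ℕ}
    (hf : Nat.Primrec' f) :
    ∀ (xs : Fin n → ℕ) (o b : ℕ), (∀ i, xs i < b) → o < b → (∀ i, xs i ≠ o) →
      ∃ P, IsStoreProgram P ∧ ∀ s : ℕ →₀ ℕ, (∀ j, b ≤ j → s j = 0) →
        Yields P s (s + single o (f (List.Vector.ofFn fun i => s (xs i)))) := by
  induction hf with
  | zero => exact fun xs o b _ _ _ => ⟨_, .skip, fun s _ => by simpa using yields_skip s⟩
  | succ =>
    intro xs o b hxs ho hxo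
    obtain ⟨P, hP, hP'⟩ := exists_copy (hxo 0) (hxs 0).ne ho.ne
    refine ⟨_, hP.comp (.inc o), fun s hs => ?_⟩
    convert (hP' s (hs b le_rfl)).comp (yields_inc _ o) using 1
    simp [add_assoc, ← single_add]
  | get i =>
    intro xs o b hxs ho hxo
    obtain ⟨P, hP, hP'⟩ := exists_copy (hxo i) (hxs i).ne ho.ne
    exact ⟨P, hP, fun s hs => by simpa using hP' s (hs b le_rfl)⟩
  | @comp m n f g _ _ ihf ihg =>
    intro xs o b hxs ho hxo
    have heval : ∀ (T : Finset (Fin n)) (w : Fin n → ℕ) (j : ℕ), (∀ i ∈ T, b + i ≠ j) →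
        (∑ i ∈ T, single (b + (i : ℕ)) (w i)) j = 0 := by
      intro T w j hj
      rw [Finsupp.finsetSum_apply]
      exact Finset.sum_eq_zero fun i hi => by simp [hj i hi]
    have hargs : ∀ T : Finset (Fin n), ∃ P, IsStoreProgram P ∧
        ∀ s : ℕ →₀ ℕ, (∀ j, b ≤ j → s j = 0) →
          Yields P s (s + ∑ i ∈ T, single (b + (i : ℕ))
            (g i (List.Vector.ofFn fun i => s (xs i)))) := by
      intro T
      induction T using Finset.induction_on with
      | empty => exact ⟨_, .skip, fun s _ => by simpa using yields_skip s⟩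
      | insert i T hi ih =>
        obtain ⟨P, hP, hP'⟩ := ih
        obtain ⟨Q, hQ, hQ'⟩ := ihg i xs (b + i) (b + n)
          (fun j => (hxs j).trans_le (by omega)) (by omega)
          (fun j => by have := hxs j; omega)
        refine ⟨_, hP.comp hQ, fun s hs => ?_⟩
        convert (hP' s hs).comp (hQ' _ ?_) using 1
        · have hx : ∀ j, (s + ∑ i ∈ T, single (b + (i : ℕ))
              (g i (List.Vector.ofFn fun i => s (xs i)))) (xs j) = s (xs j) := by
            intro j
            rw [Finsupp.add_apply, heval _ _ _ fun i _ => by have := hxs j; omega, add_zero]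
          simp only [hx]
          rw [Finset.sum_insert hi]
          abel
        · intro j hj
          rw [Finsupp.add_apply, hs j (by omega), heval _ _ _ fun i _ => by omega]
    have hclear : ∀ T : Finset (Fin n), ∃ P, IsStoreProgram P ∧
        ∀ (r : ℕ →₀ ℕ) (w : Fin n → ℕ), (∀ j, b ≤ j → r j = 0) →
          Yields P (r + ∑ i ∈ T, single (b + (i : ℕ)) (w i)) r := by
      intro T
      induction T using Finset.induction_on with
      | empty => exact ⟨_, .skip, fun s _ _ => by simpa using yields_skip s⟩
      | insert i T hi ih =>
        obtain ⟨P, hP, hP'⟩ := ih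
        obtain ⟨Q, hQ, hQ'⟩ := exists_clear (b + i)
        refine ⟨_, hQ.comp hP, fun r w hr => ?_⟩
        convert (hQ' _ (w i) ?_).comp (hP' r w hr) using 1
        · rw [Finset.sum_insert hi]
          abel
        · rw [Finsupp.add_apply, hr _ (by omega), heval]
          intro j hj hji
          exact hi (by rwa [← Fin.ext (Nat.add_left_cancel hji)])
    obtain ⟨P, hP, hP'⟩ := hargs Finset.univ
    obtain ⟨Q, hQ, hQ'⟩ := ihf (fun i => b + i) o (b + n) (fun i => by omega) (by omega)
      (fun i => by omega)
    obtain ⟨R, hR, hR'⟩ := hclear Finset.univ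
    refine ⟨_, (hP.comp hQ).comp hR, fun s hs => ?_⟩
    set w : Fin n → ℕ := fun i => g i (List.Vector.ofFn fun i => s (xs i))
    have hw : ∀ i : Fin n, (s + ∑ i : Fin n, single (b + (i : ℕ)) (w i)) (b + i) = w i := by
      intro i
      rw [Finsupp.add_apply, hs _ (by omega), zero_add,
        ← Finset.add_sum_erase _ _ (Finset.mem_univ i), Finsupp.add_apply, heval]
      · simp
      · intro j hj hji
        exact (Finset.mem_erase.1 hj).1 (Fin.ext (Nat.add_left_cancel hji))
    have h₁ := hQ' (s + ∑ i : Fin n, single (b + (i : ℕ)) (w i)) (by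
      intro j hj
      rw [Finsupp.add_apply, hs j (by omega), heval _ _ _ fun i _ => by omega])
    simp only [hw] at h₁
    rw [add_right_comm] at h₁
    refine ((hP' s hs).comp h₁).comp (hR' _ w ?_)
    intro j hj
    rw [Finsupp.add_apply, hs j hj, single_eq_of_ne (by omega), add_zero]
  | @prec n f g _ _ ihf ihg =>
    intro xs o b hxs ho hxo
    have hx := fun i => (hxs i).ne
    obtain ⟨P₁, hP₁, hP₁'⟩ := exists_copy (c := xs 0) (o := b) (tmp := b + 1) (hxs 0).ne
      (by have := hxs 0; omega) (by omega)
    obtain ⟨P₂, hP₂, hP₂'⟩ := ihf (fun i => xs i.succ) (b + 2) (b + 4)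
      (fun i => by have := hxs i.succ; omega) (by omega) (fun i => by have := hxs i.succ; omega)
    obtain ⟨Q₁, hQ₁, hQ₁'⟩ := ihg (Fin.cons (b + 1) (Fin.cons (b + 2) fun i => xs i.succ))
      (b + 3) (b + 4)
      (by
        intro i
        refine Fin.cases ?_ (fun i => Fin.cases ?_ (fun i => ?_) i) i
        · simp
        · simp
        · have := hxs i.succ
          simp only [Fin.cons_succ]
          omega)
      (by omega)
      (by
        intro i
        refine Fin.cases ?_ (fun i => Fin.cases ?_ (fun i => ?_) i) i
        · simp
        · simp
        · have := hxs i.succ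
          simp only [Fin.cons_succ]
          omega)
    obtain ⟨Q₂, hQ₂, hQ₂'⟩ := exists_clear (b + 2)
    obtain ⟨Q₃, hQ₃, hQ₃'⟩ := exists_move (c := b + 3) (o := b + 2) (by omega)
    obtain ⟨P₃, hP₃, hP₃'⟩ := exists_move (c := b + 2) (o := o) (by omega)
    obtain ⟨P₄, hP₄, hP₄'⟩ := exists_clear (b + 1)
    refine ⟨_, (((hP₁.comp hP₂).comp
      ((((hQ₁.comp hQ₂).comp hQ₃).comp (.inc (b + 1))).loop b)).comp hP₃).comp hP₄,
      fun s hs => ?_⟩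
    set v : List.Vector ℕ n := List.Vector.ofFn fun i => s (xs i.succ)
    set h : ℕ → ℕ := fun k => k.rec (f v) fun y IH => g (y ::ᵥ IH ::ᵥ v) with h_def
    have hsucc : ∀ k, h (k + 1) = g (k ::ᵥ h k ::ᵥ v) := fun _ => rfl
    have hne : ∀ i k m, single (b + k) m (xs i) = 0 := fun i k m =>
      single_eq_of_ne (by have := hxs i; omega)
    have hne0 : ∀ i m, single b m (xs i) = 0 := fun i m => single_eq_of_ne (hx i)
    have h₁ := hP₁' s (hs _ (by omega))
    have h₂ := hP₂' (s + single b (s (xs 0))) (by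
      intro j hj
      rw [Finsupp.add_apply, hs j (by omega), single_eq_of_ne (by omega), add_zero])
    simp only [Finsupp.add_apply, hne0, add_zero] at h₂
    have hloop := yields_loop (c := b)
      (B := Comp (Comp (Comp Q₁ Q₂) Q₃) (fun s t => t = s + single (b + 1) 1))
      (fun j => s + single (b + 1) j + single (b + 2) (h j))
      (by simp [hs]) ?_ (s (xs 0)) 0
    · simp only [single_zero, add_zero, zero_add] at hloop
      rw [add_right_comm] at hloop
      have h₃ := hP₃' (s + single (b + 1) (s (xs 0))) (h (s (xs 0))) (by simp [hs])
      rw [add_right_comm _ _ (single o _)] at h₃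
      have h₄ := hP₄' (s + single o (h (s (xs 0)))) (s (xs 0))
        (by simp [hs, show b + 1 ≠ o by omega])
      convert (((h₁.comp h₂).comp hloop).comp h₃).comp h₄ using 1
      simp only [List.Vector.tail_ofFn, List.Vector.head_ofFn, h_def, v]
    · intro j k
      have k₁ := hQ₁' (s + single (b + 1) j + single (b + 2) (h j) + single b k) (by
        intro i hi
        simp [hs i (by omega), show i ≠ b by omega, show i ≠ b + 1 by omega,
          show i ≠ b + 2 by omega])
      have hv : List.Vector.ofFn (fun i : Fin (n + 2) =>
          (s + single (b + 1) j + single (b + 2) (h j) + single b k)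
            ((Fin.cons (b + 1) (Fin.cons (b + 2) fun i => xs i.succ) : Fin (n + 2) → ℕ) i)) =
          j ::ᵥ h j ::ᵥ v := by
        rw [List.Vector.ofFn, List.Vector.ofFn]
        simp [hs, hne, hne0, v]
      rw [hv, ← hsucc] at k₁
      have k₂ := hQ₂' (s + single (b + 1) j + single b k + single (b + 3) (h (j + 1))) (h j)
        (by simp [hs])
      have k₃ := hQ₃' (s + single (b + 1) j + single b k) (h (j + 1)) (by simp [hs])
      rw [show s + single (b + 1) j + single (b + 2) (h j) + single b k +
        single (b + 3) (h (j + 1)) = s + single (b + 1) j + single b k +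
          single (b + 3) (h (j + 1)) + single (b + 2) (h j) by abel] at k₁
      convert ((k₁.comp k₂).comp k₃).comp (yields_inc _ (b + 1)) using 1
      rw [single_add]
      abel

end StorePrograms

section Undecidability

open Finsupp Relation

theorem reflTransGen_inc_iff {i : ℕ} {s t : ℕ →₀ ℕ} :
    ReflTransGen (fun s t => t = s + single i 1) s t ↔ ∃ n, t = s + single i n := by
  constructor
  · intro h
    induction h with
    | refl => exact ⟨0, by simp⟩
    | tail _ h ih =>
      obtain ⟨n, rfl⟩ := ih
      exact ⟨n + 1, by rw [h, single_add, add_assoc]⟩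
  · rintro ⟨n, rfl⟩
    induction n with
    | zero => simpa using ReflTransGen.refl
    | succ n ih => exact ih.tail (by rw [single_add, add_assoc])

/-- Projections of zero sets of primitive recursive functions are reachability sets of rational
transitions. -/
theorem Nat.Primrec'.exists_isRationalTransition {g : List.Vector ℕ 2 → ℕ}
    (hg : Nat.Primrec' g) :
    ∃ R, IsRationalTransition R ∧ ∀ n, R 1 (2 ^ n) ↔ ∃ k, g (n ::ᵥ k ::ᵥ .nil) = 0 := by
  obtain ⟨P, hP, hP'⟩ := hg.exists_isStoreProgram (fun i => i) 2 3 (fun i => by omega)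
    (by omega) (fun i => by omega)
  obtain ⟨Q, hQ, hQ'⟩ := exists_clear 1
  obtain ⟨R, hR, hR'⟩ := ((((IsStoreProgram.inc 0).star.comp (IsStoreProgram.inc 1).star).comp
    hP).comp ((IsStoreProgram.isZero 2).comp hQ)).exists_isRationalTransition
  have hcode : ∀ n, storeCode (single 0 n) = 2 ^ n := fun n => by
    rw [storeCode_single, Nat.nth_prime_zero_eq_two]
  have hone : storeCode 0 = 1 := by simpa using hcode 0
  have hPg : ∀ n k, Yields P (single 0 n + single 1 k)
      (single 0 n + single 1 k + single 2 (g (n ::ᵥ k ::ᵥ .nil))) := by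
    intro n k
    convert hP' (single 0 n + single 1 k) ?_ using 4
    · simp [List.Vector.ofFn]
    · intro j hj
      simp [show j ≠ 0 by omega, show j ≠ 1 by omega]
  refine ⟨R, hR, fun n => ?_⟩
  have hR₁ := hR' 0 (2 ^ n)
  rw [hone] at hR₁
  rw [hR₁]
  constructor
  · rintro ⟨t, ht, s₃, ⟨s₂, ⟨s₁, h₁, h₂⟩, h₃⟩, s₄, ⟨h₀, rfl⟩, h₄⟩
    obtain ⟨m, rfl⟩ := reflTransGen_inc_iff.1 h₁
    obtain ⟨k, rfl⟩ := reflTransGen_inc_iff.1 h₂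
    rw [zero_add] at h₃
    rw [(hPg m k _).1 h₃] at h₀ h₄
    have hg0 : g (m ::ᵥ k ::ᵥ .nil) = 0 := by simpa using h₀
    rw [hg0, single_zero, add_zero, hQ' (single 0 m) k (by simp)] at h₄
    rw [h₄, hcode] at ht
    rw [Nat.pow_right_injective le_rfl ht]
    exact ⟨k, hg0⟩
  · rintro ⟨k, hk⟩
    refine ⟨single 0 n, (hcode n).symm, single 0 n + single 1 k, ⟨_,
      ⟨_, reflTransGen_inc_iff.2 ⟨n, rfl⟩, reflTransGen_inc_iff.2 ⟨k, rfl⟩⟩, ?_⟩,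
      single 0 n + single 1 k, ⟨?_, rfl⟩, ?_⟩
    · rw [zero_add, hPg, hk, single_zero, add_zero]
    · simp
    · exact (hQ' _ k (by simp) _).2 rfl

theorem exists_isRationalTransition_iff_dom :
    ∃ R, IsRationalTransition R ∧
      ∀ c : Nat.Partrec.Code, R 1 (2 ^ Encodable.encode c) ↔ (c.eval 0).Dom := by
  let e : List.Vector ℕ 2 → ℕ := fun v =>
    if (Nat.Partrec.Code.evaln v.tail.head (Denumerable.ofNat _ v.head) 0).isSome then 0 else 1
  have he : Primrec e := by
    have h : Primrec fun v : List.Vector ℕ 2 =>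
        Nat.Partrec.Code.evaln v.tail.head (Denumerable.ofNat _ v.head) 0 :=
      Nat.Partrec.Code.primrec_evaln.comp
        (((Primrec.vector_head.comp Primrec.vector_tail).pair
          ((Primrec.ofNat _).comp Primrec.vector_head)).pair (Primrec.const 0))
    exact Primrec.ite (Primrec.eq.comp (Primrec.option_isSome.comp h) (Primrec.const true))
      (Primrec.const 0) (Primrec.const 1)
  obtain ⟨R, hR, hR'⟩ := (Nat.Primrec'.of_prim he).exists_isRationalTransition
  refine ⟨R, hR, fun c => ?_⟩
  rw [hR', Part.dom_iff_mem]
  simp only [e, List.Vector.head_cons, List.Vector.tail_cons, Denumerable.ofNat_encode,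
    ite_eq_left_iff, one_ne_zero, imp_false, not_not, Option.isSome_iff_exists,
    Nat.Partrec.Code.evaln_complete]
  exact exists_comm

end Undecidability

/-- Let `M` be a finitely generated left-cancellative monoid and `U ⊆ M` a subset such
that `u·v` and `v` are L-related for all `u, v ∈ U`.  If the submonoid generated by `U`
is isomorphic to the trace monoid `T(P_4)`, then `M` contains a fixed rational subset in
which membership is undecidable. -/
theorem undecidable_rational_subset_of_L_related_trace_monoid
    (k : ℕ) (M : Type) [Monoid M]
    (hcancel : ∀ x y z : M, x * y = x * z → y = z)
    (gen : Fin k → M)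
    (hsurj : Function.Surjective fun w : List (Fin k) => (w.map gen).prod)
    (U : Set M)
    (hLrel : ∀ u ∈ U, ∀ v ∈ U,
      (Set.range fun m : M => m * (u * v)) = Set.range fun m : M => m * v)
    (hU : Nonempty (↥(Submonoid.closure U) ≃* TP4)) :
    ∃ L : Language (Fin k), L.IsRegular ∧
      ¬ ComputablePred fun w : List (Fin k) =>
        (w.map gen).prod ∈ (fun u : List (Fin k) => (u.map gen).prod) '' L := by
  obtain ⟨e⟩ := hU
  let φ : TP4 →* M := (Submonoid.closure U).subtype.comp e.symm.toMonoidHom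
  have hφ : Function.Injective φ := Subtype.val_injective.comp e.symm.injective
  have hφU : ∀ i, φ (TP4.gen i) ∈ U := TP4.symm_gen_mem e
  have hdel : ∀ i j : Fin 4, ∃ m : M, m * (φ (TP4.gen i) * φ (TP4.gen j)) = φ (TP4.gen j) := by
    intro i j
    have h : φ (TP4.gen j) ∈ Set.range fun m : M => m * φ (TP4.gen j) := ⟨1, one_mul _⟩
    rwa [← hLrel _ (hφU i) _ (hφU j)] at h
  obtain ⟨R, hR, hRdom⟩ := exists_isRationalTransition_iff_dom
  obtain ⟨S, hS, hSR⟩ := hR.exists_rational_set hcancel hφ hdel 1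
  obtain ⟨L, hL, rfl⟩ := hS.exists_isRegular gen hsurj
  refine ⟨L, hL, fun hdec => ComputablePred.halting_problem 0 ?_⟩
  obtain ⟨d, hd⟩ := hsurj (φ (TP4.gen 1))
  obtain ⟨w, hw⟩ := hsurj (φ (TP4.gen 3))
  refine ComputablePred.computable_of_manyOneReducible ⟨fun c =>
    (List.range (2 ^ Encodable.encode c)).flatMap (fun _ => d) ++ w, ?_, fun c => ?_⟩ hdec
  · refine Primrec.to_comp (Primrec.list_append.comp (Primrec.list_flatMap (Primrec.list_range.comp
      ?_) (Primrec.const d).to₂) (Primrec.const w))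
    exact (Primrec₂.unpaired'.1 Nat.Primrec.pow).comp (Primrec.const 2) Primrec.encode
  · obtain ⟨y, hy⟩ := Nat.exists_eq_succ_of_ne_zero (pow_ne_zero (Encodable.encode c) two_ne_zero)
    have hpow : ∀ m, (((List.range m).flatMap fun _ => d).map gen).prod =
        (d.map gen).prod ^ m := by
      intro m
      induction m with
      | zero => simp
      | succ m ih => simpa [List.range_succ, pow_succ] using congrArg (· * (d.map gen).prod) ih
    have hprod : (((List.range (2 ^ Encodable.encode c)).flatMap (fun _ => d) ++ w).map gen).prod =
        φ (TP4.configTrace (y + 1)) := by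
      rw [TP4.configTrace, map_mul, map_pow, ← hd, ← hw, List.map_append, List.prod_append, hpow,
        hy]
    refine (hRdom c).symm.trans ?_
    rw [hprod, hSR, hy]
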